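/- arXiv:math/0507167 — 3 statements merged into one kernel-verified Lean document; each statement's English description precedes it below -/
import Mathlib

section
/- Let Φ : A^(ℤ^D) → A^(ℤ^D) be a cellular automaton and let 𝔄 be a subshift with Φ(𝔄) = 𝔄 and Φ injective on 𝔄 (so Φ restricts to a bijection of 𝔄). Then every essential defect is Φ-persistent: if a ∈ 𝔄̃ has an essential defect, then Φ^t(a) ∉ 𝔄 for every t ∈ ℕ. -/
open scoped ENNReal

namespace Defects

/-- The configuration space `A^(ℤ^D)`. -/
abbrev Config (D : ℕ) (A : Type) := (Fin D → ℤ) → A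

variable {D : ℕ} {A : Type}

/-- The shift `σ^v`. -/
def shift (v : Fin D → ℤ) (a : Config D A) : Config D A := fun z => a (z + v)

/-- A subshift: a nonempty closed shift-invariant subset of `A^(ℤ^D)`. -/
def IsSubshift [TopologicalSpace A] (𝔄 : Set (Config D A)) : Prop :=
  𝔄.Nonempty ∧ IsClosed 𝔄 ∧ ∀ v : Fin D → ℤ, shift v '' 𝔄 = 𝔄

/-- The cube `B(r) = [-r, r]^D ⊆ ℤ^D`. -/
def ballZ (D r : ℕ) : Set (Fin D → ℤ) := {w | ∀ i, |w i| ≤ (r : ℤ)}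

/-- The `r`-block of `a` at `z`, as an element of `A^(B(r))`. -/
def blockAt (r : ℕ) (a : Config D A) (z : Fin D → ℤ) : ballZ D r → A :=
  fun w => a (z + w.1)

/-- The set `𝔄_(r)` of admissible `r`-blocks. -/
def admissibleBlocks (𝔄 : Set (Config D A)) (r : ℕ) : Set (ballZ D r → A) :=
  (fun a => blockAt r a 0) '' 𝔄

/-- `G_R(a)`: the set of `z` where the `R`-block of `a` is admissible. -/
def goodSet (𝔄 : Set (Config D A)) (R : ℕ) (a : Config D A) : Set (Fin D → ℤ) :=
  {z | blockAt R a z ∈ admissibleBlocks 𝔄 R}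

/-- `𝔄̃`: configurations having arbitrarily large admissible regions. -/
def almostAdmissible (𝔄 : Set (Config D A)) : Set (Config D A) :=
  {a | ∀ R : ℕ, (goodSet 𝔄 R a).Nonempty}

/-- The defect of `a` is removable if some `a' ∈ 𝔄` agrees with `a` on `G_r(a)`. -/
def Removable (𝔄 : Set (Config D A)) (a : Config D A) : Prop :=
  ∃ r : ℕ, ∃ a' ∈ 𝔄, ∀ z ∈ goodSet 𝔄 r a, a' z = a z

/-- A cellular automaton: continuous and commuting with all shifts. -/
def IsCellularAutomaton [TopologicalSpace A] (Φ : Config D A → Config D A) : Prop :=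
  Continuous Φ ∧ ∀ v : Fin D → ℤ, Φ ∘ shift v = shift v ∘ Φ

/-- `Φ` has radius `R`: `Φ(a)(z)` depends only on the `R`-block of `a` at `z`. -/
def HasRadius {B : Type} (Φ : Config D A → Config D B) (R : ℕ) : Prop :=
  ∀ a b : Config D A, ∀ z : Fin D → ℤ, blockAt R a z = blockAt R b z → Φ a z = Φ b z

/-- `E = {±e_1, …, ±e_D}`. -/
def stdSteps (D : ℕ) : Set (Fin D → ℤ) :=
  {v | ∃ i : Fin D, v = Pi.single i 1 ∨ v = -Pi.single i 1}

/-- A subshift homomorphism `Φ : 𝔄 → 𝔅`. -/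
def IsSubshiftHom {B : Type} [TopologicalSpace A] [TopologicalSpace B]
    (𝔄 : Set (Config D A)) (𝔅 : Set (Config D B)) (Φ : Config D A → Config D B) : Prop :=
  Set.MapsTo Φ 𝔄 𝔅 ∧ ContinuousOn Φ 𝔄 ∧
    ∀ v : Fin D → ℤ, ∀ a ∈ 𝔄, Φ (shift v a) = shift v (Φ a)

/-- `Φ` has radius `R` as a map on `𝔄`. -/
def HomHasRadius {B : Type} (𝔄 : Set (Config D A)) (Φ : Config D A → Config D B)
    (R : ℕ) : Prop :=
  ∀ a ∈ 𝔄, ∀ a' ∈ 𝔄, ∀ z : Fin D → ℤ, blockAt R a z = blockAt R a' z → Φ a z = Φ a' z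

/-! ### Dynamical cocycles (multiplicative) -/

/-- A continuous `G`-valued (dynamical) cocycle on `𝔄`. -/
def DynCocycleOn [TopologicalSpace A] {G : Type} [Group G] [TopologicalSpace G] (𝔄 : Set (Config D A))
    (C : (Fin D → ℤ) → Config D A → G) : Prop :=
  (∀ z : Fin D → ℤ, ContinuousOn (C z) 𝔄) ∧
    ∀ y z : Fin D → ℤ, ∀ a ∈ 𝔄, C (y + z) a = C y (shift z a) * C z a

/-- Cohomologous cocycles, via a continuous transfer function. -/
def DynCohomologous [TopologicalSpace A] {G : Type} [Group G] [TopologicalSpace G] (𝔄 : Set (Config D A))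
    (C C' : (Fin D → ℤ) → Config D A → G) : Prop :=
  ∃ b : Config D A → G, ContinuousOn b 𝔄 ∧
    ∀ z : Fin D → ℤ, ∀ a ∈ 𝔄, C' z a = b (shift z a) * C z a * (b a)⁻¹

/-- A trivial cocycle: cohomologous to a homomorphism `ℤ^D → G`. -/
def DynTrivial [TopologicalSpace A] {G : Type} [Group G] [TopologicalSpace G] (𝔄 : Set (Config D A))
    (C : (Fin D → ℤ) → Config D A → G) : Prop :=
  ∃ h : (Fin D → ℤ) → G, (∀ y z : Fin D → ℤ, h (y + z) = h y * h z) ∧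
    DynCohomologous 𝔄 C (fun z _ => h z)

/-- A cocycle is locally determined with radius `r` if `C(e, ·)` (for `e ∈ E`)
depends only on the `r`-block at `0`. -/
def LocallyDetermined {G : Type} [Group G] (𝔅 : Set (Config D A))
    (C : (Fin D → ℤ) → Config D A → G) (r : ℕ) : Prop :=
  ∀ e ∈ stdSteps D, ∀ b ∈ 𝔅, ∀ b' ∈ 𝔅,
    blockAt r b 0 = blockAt r b' 0 → C e b = C e b'

/-- A fundamental cocycle: every continuous cocycle into a discrete group is
cohomologous to a homomorphic image of `Cstar`. -/
def IsFundamental [TopologicalSpace A] {Gs : Type} [Group Gs] [TopologicalSpace Gs] (𝔄 : Set (Config D A))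
    (Cstar : (Fin D → ℤ) → Config D A → Gs) : Prop :=
  ∀ (H : Type) [Group H] [TopologicalSpace H] [DiscreteTopology H],
    ∀ C : (Fin D → ℤ) → Config D A → H,
      DynCocycleOn 𝔄 C → ∃ ψ : Gs →* H, DynCohomologous 𝔄 C fun z a => ψ (Cstar z a)


/-! ### Trails and locally determined cocycles via local rules -/

/-- A trail: a nonempty sequence in `ℤ^D` whose successive steps lie in `E`. -/
def IsTrail (ζ : List (Fin D → ℤ)) : Prop :=
  ζ ≠ [] ∧ ζ.Chain' fun x y => y - x ∈ stdSteps D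

/-- The trail `ζ` lies in `Y`. -/
def TrailIn (Y : Set (Fin D → ℤ)) (ζ : List (Fin D → ℤ)) : Prop := ∀ z ∈ ζ, z ∈ Y

/-- A closed trail: the first and last points coincide. -/
def IsClosedTrail (ζ : List (Fin D → ℤ)) : Prop := ζ.head? = ζ.getLast?

/-- Concatenation of trails (the final point of `ζ` should equal the initial
point of `ξ`). -/
def trailConcat (ζ ξ : List (Fin D → ℤ)) : List (Fin D → ℤ) := ζ ++ ξ.tail

/-- The value `c(ζ, a)` of a local rule along a trail, later steps multiplied
on the left. -/
def trailVal {G : Type} [Group G] {r : ℕ} (c : (Fin D → ℤ) → (ballZ D r → A) → G)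
    (a : Config D A) : List (Fin D → ℤ) → G
  | [] => 1
  | [_] => 1
  | x :: y :: rest => trailVal c a (y :: rest) * c (y - x) (blockAt r a x)

/-- A local rule of radius `r` for a `G`-valued cocycle on `𝔄`. -/
def IsLocalRule {G : Type} [Group G] (𝔄 : Set (Config D A)) (r : ℕ)
    (c : (Fin D → ℤ) → (ballZ D r → A) → G) : Prop :=
  ∀ a : Config D A, ∀ e ∈ stdSteps D, ∀ e' ∈ stdSteps D,
    ((0 ∈ goodSet 𝔄 r a ∧ e ∈ goodSet 𝔄 r a ∧ e' ∈ goodSet 𝔄 r a ∧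
        e + e' ∈ goodSet 𝔄 r a) →
      c e' (blockAt r a e) * c e (blockAt r a 0) =
        c e (blockAt r a e') * c e' (blockAt r a 0)) ∧
    ((0 ∈ goodSet 𝔄 r a ∧ e ∈ goodSet 𝔄 r a) →
      c (-e) (blockAt r a e) = (c e (blockAt r a 0))⁻¹)

/-- Elementary `Y`-homotopies of trails. -/
inductive ElemHomotopy (Y : Set (Fin D → ℤ)) :
    List (Fin D → ℤ) → List (Fin D → ℤ) → Prop
  | slide (pre post : List (Fin D → ℤ)) (x y z : Fin D → ℤ)
      (hxy : y - x ∈ stdSteps D) (hyz : z - y ∈ stdSteps D) (hw : x + z - y ∈ Y) :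
      ElemHomotopy Y (pre ++ x :: y :: z :: post) (pre ++ x :: (x + z - y) :: z :: post)
  | delBacktrack (pre post : List (Fin D → ℤ)) (x y : Fin D → ℤ)
      (hstep : y - x ∈ stdSteps D) :
      ElemHomotopy Y (pre ++ x :: y :: x :: post) (pre ++ x :: post)
  | insBacktrack (pre post : List (Fin D → ℤ)) (x y : Fin D → ℤ)
      (hy : y ∈ Y) (hstep : y - x ∈ stdSteps D) :
      ElemHomotopy Y (pre ++ x :: post) (pre ++ x :: y :: x :: post)

/-- Two trails are `Y`-homotopic if joined by a finite chain of elementary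
`Y`-homotopies. -/
def TrailHomotopic (Y : Set (Fin D → ℤ)) : List (Fin D → ℤ) → List (Fin D → ℤ) → Prop :=
  Relation.ReflTransGen fun p q => ElemHomotopy Y p q ∨ ElemHomotopy Y q p

/-- Points `z`, `y` joined by a trail lying in `Y`. -/
def TrailConnIn (Y : Set (Fin D → ℤ)) (z y : Fin D → ℤ) : Prop :=
  ∃ (ζ : List (Fin D → ℤ)) (h : ζ ≠ []),
    IsTrail ζ ∧ TrailIn Y ζ ∧ ζ.head h = z ∧ ζ.getLast h = y

/-- `a` has a projective `c`-pole: for every `R ≥ r` there is a closed trail in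
`G_R(a)` with nontrivial value. -/
def HasProjPole {G : Type} [Group G] (𝔄 : Set (Config D A)) (r : ℕ)
    (c : (Fin D → ℤ) → (ballZ D r → A) → G) (a : Config D A) : Prop :=
  ∀ R : ℕ, r ≤ R → ∃ ζ : List (Fin D → ℤ),
    IsTrail ζ ∧ IsClosedTrail ζ ∧ TrailIn (goodSet 𝔄 R a) ζ ∧ trailVal c a ζ ≠ 1

/-- Restriction of a `ρ`-block to an `r`-block (`r ≤ ρ`). -/
def restrictBlock {r ρ : ℕ} (h : r ≤ ρ) (p : ballZ D ρ → A) : ballZ D r → A :=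
  fun w => p ⟨w.1, by
    intro i
    exact le_trans (w.2 i) (by exact_mod_cast h)⟩

/-- The lift of a local rule of radius `r` to radius `ρ ≥ r`. -/
def liftRule {G : Type} [Group G] {r ρ : ℕ} (h : r ≤ ρ)
    (c : (Fin D → ℤ) → (ballZ D r → A) → G) :
    (Fin D → ℤ) → (ballZ D ρ → A) → G :=
  fun e p => c e (restrictBlock h p)

/-- Local rules of radius `ρ` are locally cohomologous via a local transfer
function of some radius `s ≤ ρ`. -/
def LocallyCohomologous {G : Type} [Group G] (𝔄 : Set (Config D A)) (ρ : ℕ)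
    (c₁ c₂ : (Fin D → ℤ) → (ballZ D ρ → A) → G) : Prop :=
  ∃ (s : ℕ) (_ : s ≤ ρ) (b : (ballZ D s → A) → G),
    ∀ a : Config D A, ∀ e ∈ stdSteps D,
      (0 ∈ goodSet 𝔄 ρ a ∧ e ∈ goodSet 𝔄 ρ a) →
      c₂ e (blockAt ρ a 0) = b (blockAt s a e) * c₁ e (blockAt ρ a 0) *
        (b (blockAt s a 0))⁻¹

/-- Extend a block to a configuration (arbitrarily outside the block). -/
noncomputable def blockExtend [Nonempty A] {ρ : ℕ} (p : ballZ D ρ → A) : Config D A :=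
  fun z => @dite A (z ∈ ballZ D ρ) (Classical.propDecidable _)
    (fun h => p ⟨z, h⟩) (fun _ => Classical.arbitrary A)

/-- The block map `Φ̄ : 𝔄_(r+R) → 𝔄_(r)` induced by a CA `Φ` of radius `R`. -/
noncomputable def blockMapCA [Nonempty A] (Φ : Config D A → Config D A) (R r : ℕ)
    (p : ballZ D (r + R) → A) : ballZ D r → A :=
  blockAt r (Φ (blockExtend p)) 0

/-- The pullback local rule `Φ_* c` of radius `r + R`. -/
noncomputable def pullRule [Nonempty A] {G : Type} [Group G]
    (Φ : Config D A → Config D A) (R r : ℕ)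
    (c : (Fin D → ℤ) → (ballZ D r → A) → G) :
    (Fin D → ℤ) → (ballZ D (r + R) → A) → G :=
  fun e p => c e (blockMapCA Φ R r p)

/-- Two local rules (of radii `r₁`, `r₂`) define the same class in
`H¹_loc(𝔄, G)`. -/
def SameHlocClass {G : Type} [CommGroup G] (𝔄 : Set (Config D A)) {r₁ r₂ : ℕ}
    (c₁ : (Fin D → ℤ) → (ballZ D r₁ → A) → G)
    (c₂ : (Fin D → ℤ) → (ballZ D r₂ → A) → G) : Prop :=
  ∃ (ρ : ℕ) (h₁ : r₁ ≤ ρ) (h₂ : r₂ ≤ ρ) (h : (Fin D → ℤ) → G),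
    (∀ y z : Fin D → ℤ, h (y + z) = h y * h z) ∧
    LocallyCohomologous 𝔄 ρ (liftRule h₁ c₁) fun e p => liftRule h₂ c₂ e p * h e

/-- `a` has a projective `G`-pole: a projective `c`-pole for some `G`-valued
local rule `c` of some radius. -/
def HasProjGPole (G : Type) [Group G] (𝔄 : Set (Config D A)) (a : Config D A) : Prop :=
  ∃ (r : ℕ) (c : (Fin D → ℤ) → (ballZ D r → A) → G),
    IsLocalRule 𝔄 r c ∧ HasProjPole 𝔄 r c a

/-- A locally fundamental local rule (valued in a discrete abelian group). -/
def IsLocallyFundamental {Gs : Type} [CommGroup Gs] (𝔄 : Set (Config D A)) (rstar : ℕ)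
    (cstar : (Fin D → ℤ) → (ballZ D rstar → A) → Gs) : Prop :=
  ∀ (H : Type) [CommGroup H], ∀ (r : ℕ) (c : (Fin D → ℤ) → (ballZ D r → A) → H),
    IsLocalRule 𝔄 r c →
    ∃ (ψ : Gs →* H) (ρ : ℕ) (h₁ : rstar ≤ ρ) (h₂ : r ≤ ρ),
      LocallyCohomologous 𝔄 ρ (liftRule h₁ fun e p => ψ (cstar e p)) (liftRule h₂ c)

/-- A pseudonorm on `G`, with values in `[0, ∞]`. -/
def IsPseudonorm {G : Type} [Group G] (ν : G → ℝ≥0∞) : Prop :=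
  ν 1 = 0 ∧ (∀ g h : G, ν (g * h) = ν (h * g)) ∧ ∀ g h : G, ν (g * h) ≤ ν g + ν h

/-- The `ℓ¹`-norm on `ℤ^D`. -/
def l1norm {D : ℕ} (v : Fin D → ℤ) : ℕ := ∑ i, (v i).natAbs


/-! ### Additive dynamical and equivariant cocycles -/

/-- A continuous `(G,+)`-valued dynamical cocycle on `𝔄`. -/
def AddDynCocycleOn [TopologicalSpace A] {G : Type} [AddCommGroup G] [TopologicalSpace G]
    (𝔄 : Set (Config D A)) (C : (Fin D → ℤ) → Config D A → G) : Prop :=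
  (∀ z : Fin D → ℤ, ContinuousOn (C z) 𝔄) ∧
    ∀ y z : Fin D → ℤ, ∀ a ∈ 𝔄, C (y + z) a = C y (shift z a) + C z a

/-- Cohomologous additive cocycles. -/
def AddDynCohomologous [TopologicalSpace A] {G : Type} [AddCommGroup G] [TopologicalSpace G]
    (𝔄 : Set (Config D A)) (C C' : (Fin D → ℤ) → Config D A → G) : Prop :=
  ∃ b : Config D A → G, ContinuousOn b 𝔄 ∧
    ∀ z : Fin D → ℤ, ∀ a ∈ 𝔄, C' z a = b (shift z a) + C z a - b a

/-- The equivariant edge cocycle `Ψ(C̃)(x→y; a) = C̃(y−x, σ^x(a))` associated to a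
dynamical cocycle. -/
def edgeCocycleOf {G : Type} [AddCommGroup G] (C : (Fin D → ℤ) → Config D A → G) :
    (Fin D → ℤ) → (Fin D → ℤ) → Config D A → G :=
  fun x y a => C (y - x) (shift x a)

/-- A continuous equivariant 1-cocycle on `𝔄` (as a function of oriented edges
`x → y`, i.e. pairs with `y - x ∈ E`). -/
def IsEqCocycle [TopologicalSpace A] {G : Type} [AddCommGroup G] [TopologicalSpace G]
    (𝔄 : Set (Config D A)) (C : (Fin D → ℤ) → (Fin D → ℤ) → Config D A → G) : Prop :=
  (∀ x y : Fin D → ℤ, y - x ∈ stdSteps D → ContinuousOn (C x y) 𝔄) ∧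
  (∀ x y z : Fin D → ℤ, y - x ∈ stdSteps D → ∀ a ∈ 𝔄,
      C x y (shift z a) = C (x + z) (y + z) a) ∧
  (∀ x y : Fin D → ℤ, y - x ∈ stdSteps D → ∀ a ∈ 𝔄, C y x a = -C x y a) ∧
  (∀ s : Fin D → ℤ, ∀ i j : Fin D, i ≠ j → ∀ a ∈ 𝔄,
      C s (s + Pi.single i 1) a +
        C (s + Pi.single i 1) (s + Pi.single i 1 + Pi.single j 1) a =
      C s (s + Pi.single j 1) a +
        C (s + Pi.single j 1) (s + Pi.single i 1 + Pi.single j 1) a)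

/-- Cohomologous equivariant 1-cocycles, via an equivariant continuous
0-cochain `B`. -/
def EqCohomologous [TopologicalSpace A] {G : Type} [AddCommGroup G] [TopologicalSpace G]
    (𝔄 : Set (Config D A)) (C C' : (Fin D → ℤ) → (Fin D → ℤ) → Config D A → G) : Prop :=
  ∃ B : (Fin D → ℤ) → Config D A → G,
    (∀ x : Fin D → ℤ, ContinuousOn (B x) 𝔄) ∧
    (∀ x z : Fin D → ℤ, ∀ a ∈ 𝔄, B x (shift z a) = B (x + z) a) ∧
    ∀ x y : Fin D → ℤ, y - x ∈ stdSteps D → ∀ a ∈ 𝔄,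
      C' x y a = B y a + C x y a - B x a

/-! ### Cells, chains, and equivariant `d`-cocycles -/

/-- A cell in `ℤ^D`: a base point together with a set of spanning directions. -/
abbrev Cell (D : ℕ) := (Fin D → ℤ) × Finset (Fin D)

/-- Chains: finitely supported `ℤ`-valued functions on cells. -/
abbrev CellChain (D : ℕ) := Cell D →₀ ℤ

/-- The boundary of a single cell. -/
noncomputable def cellBoundary {D : ℕ} (cell : Cell D) : CellChain D :=
  ∑ i ∈ cell.2, ((-1 : ℤ) ^ (cell.2.filter fun j => j < i).card) •
    (Finsupp.single (cell.1 + Pi.single i 1, cell.2.erase i) (1 : ℤ) -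
      Finsupp.single (cell.1, cell.2.erase i) (1 : ℤ))

/-- The boundary homomorphism on chains. -/
noncomputable def chainBoundary {D : ℕ} (ζ : CellChain D) : CellChain D :=
  ζ.sum fun cell n => n • cellBoundary cell

/-- The value of an equivariant cochain (of radius `r`) on a chain. -/
def chainVal {G : Type} [AddCommGroup G] {r : ℕ}
    (c : Finset (Fin D) → (ballZ D r → A) → G) (a : Config D A) (ζ : CellChain D) : G :=
  ζ.sum fun cell n => n • c cell.2 (blockAt r a cell.1)

/-- An equivariant `d`-cocycle of radius `r` on `𝔄`: vanishes on boundaries of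
`(d+1)`-cells over admissible configurations. -/
def IsEqDCocycle {G : Type} [AddCommGroup G] (𝔄 : Set (Config D A)) (d r : ℕ)
    (c : Finset (Fin D) → (ballZ D r → A) → G) : Prop :=
  ∀ a ∈ 𝔄, ∀ cell : Cell D, cell.2.card = d + 1 →
    chainVal c a (cellBoundary cell) = 0

/-- `a` has a projective `(G,d)`-pole. -/
def HasProjDPole (G : Type) [AddCommGroup G] (𝔄 : Set (Config D A)) (d : ℕ)
    (a : Config D A) : Prop :=
  ∃ (r : ℕ) (c : Finset (Fin D) → (ballZ D r → A) → G),
    IsEqDCocycle 𝔄 d r c ∧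
    ∀ R : ℕ, r ≤ R → ∃ ζ : CellChain D,
      (∀ cell ∈ ζ.support, (cell : Cell D).2.card = d) ∧
      chainBoundary ζ = 0 ∧
      (∀ cell ∈ ζ.support, (cell : Cell D).1 ∈ goodSet 𝔄 R a) ∧
      chainVal c a ζ ≠ 0


theorem shift_apply_mem {𝔄 : Set (Config D A)} (h : ∀ v : Fin D → ℤ, shift v '' 𝔄 = 𝔄)
    {a : Config D A} (ha : a ∈ 𝔄) (v : Fin D → ℤ) : shift v a ∈ 𝔄 :=
  h v ▸ Set.mem_image_of_mem _ ha

theorem eventually_mem_ballZ (z : Fin D → ℤ) : ∀ᶠ r : ℕ in Filter.atTop, z ∈ ballZ D r := by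
  refine Filter.eventually_all.2 fun i => ?_
  filter_upwards [Filter.eventually_ge_atTop (z i).natAbs] with r hr
  rw [Int.abs_eq_natAbs]
  exact_mod_cast hr

/-- If a continuous shift-commuting map `Ψ` is injective on a closed shift-invariant set `𝔄`,
then a configuration having the same `Ψ`-image as some element of `𝔄` has a removable defect. -/
theorem removable_of_apply_eq [Finite A] [TopologicalSpace A] [DiscreteTopology A]
    {𝔄 : Set (Config D A)} (hclosed : IsClosed 𝔄) (hshift : ∀ v : Fin D → ℤ, shift v '' 𝔄 = 𝔄)
    {Ψ : Config D A → Config D A} (hcont : Continuous Ψ)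
    (hcomm : ∀ v : Fin D → ℤ, Function.Commute Ψ (shift v)) (hinj : Set.InjOn Ψ 𝔄)
    {a a' : Config D A} (ha' : a' ∈ 𝔄) (h : Ψ a' = Ψ a) : Removable 𝔄 a := by
  by_contra hrem
  have hbad : ∀ r : ℕ, ∃ z, ∃ c ∈ 𝔄, blockAt r c 0 = blockAt r a z ∧ a' z ≠ a z := by
    intro r
    by_contra! hr
    exact hrem ⟨r, a', ha', fun z ⟨c, hc, hcz⟩ => hr z c hc hcz⟩
  choose z c hc hblock hne using hbad
  let u := Filter.hyperfilter ℕ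
  have hlim (x : ℕ → Config D A) : ∃ y, Filter.Tendsto x u (nhds y) :=
    ⟨(u.map x).lim, (u.map x).le_nhds_lim⟩
  obtain ⟨x, hx⟩ := hlim fun r => shift (z r) a
  obtain ⟨y, hy⟩ := hlim fun r => shift (z r) a'
  have hu : (u : Filter ℕ) ≤ Filter.atTop := Nat.hyperfilter_le_atTop
  have hcx : Filter.Tendsto c u (nhds x) := by
    refine tendsto_pi_nhds.2 fun w => ((tendsto_pi_nhds.1 hx) w).congr' ?_
    filter_upwards [hu (eventually_mem_ballZ w)] with r hr
    have := congrFun (hblock r) ⟨w, hr⟩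
    simp only [blockAt, zero_add] at this
    rw [this, shift, add_comm]
  have hx𝔄 : x ∈ 𝔄 := hclosed.mem_of_tendsto hcx (Filter.Eventually.of_forall hc)
  have hy𝔄 : y ∈ 𝔄 := hclosed.mem_of_tendsto hy
    (Filter.Eventually.of_forall fun r => shift_apply_mem hshift ha' (z r))
  have hxy : x = y := by
    refine hinj hx𝔄 hy𝔄 (tendsto_nhds_unique ((hcont.tendsto x).comp hx) ?_)
    refine ((hcont.tendsto y).comp hy).congr fun r => ?_
    simp only [Function.comp_apply, (hcomm (z r)).eq, h]
  subst hxy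
  have hx0 := (tendsto_pi_nhds.1 hx) 0
  have hy0 := (tendsto_pi_nhds.1 hy) 0
  rw [nhds_discrete, Filter.tendsto_pure] at hx0 hy0
  obtain ⟨r, hr, hr'⟩ := (hx0.and hy0).exists
  simp only [shift, zero_add] at hr hr'
  exact hne r (hr'.trans hr.symm)

theorem statement_1 {D : ℕ} (hD : 1 ≤ D) {A : Type} [Fintype A] [Nonempty A]
    [TopologicalSpace A] [DiscreteTopology A]
    (𝔄 : Set (Config D A)) (h𝔄 : IsSubshift 𝔄)
    (Φ : Config D A → Config D A) (hΦ : IsCellularAutomaton Φ)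
    (hsurj : Φ '' 𝔄 = 𝔄) (hinj : Set.InjOn Φ 𝔄)
    (a : Config D A) (ha : a ∈ almostAdmissible 𝔄)
    (hess : ¬ Removable 𝔄 a) :
    ∀ t : ℕ, Φ^[t] a ∉ 𝔄 := by
  intro t ht
  have hsurj' : Set.SurjOn Φ 𝔄 𝔄 := hsurj.ge
  have hmaps : Set.MapsTo Φ 𝔄 𝔄 := Set.mapsTo_iff_image_subset.2 hsurj.le
  obtain ⟨a', ha', h⟩ := hsurj'.iterate t ht
  exact hess (removable_of_apply_eq h𝔄.2.1 h𝔄.2.2 (hΦ.1.iterate t)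
    (fun v => Function.Commute.iterate_left (show Function.Commute Φ (shift v) from congrFun (hΦ.2 v)) t)
    (hinj.iterate hmaps t) ha' h)

end Defects
end

section
/- Let 𝔄 be a subshift with a fundamental continuous cocycle C* valued in a discrete abelian group (G*,·), and let Φ : 𝔄 → 𝔄 be a continuous shift-commuting map. Then there exists a group endomorphism φ of G* such that for every group endomorphism ε of G*, the pullback Φ_*(ε∘C*) is cohomologous to (ε∘φ)∘C*. -/
open scoped ENNReal

namespace Defects

variable {D : ℕ} {A : Type}

theorem statement_5 {D : ℕ} (hD : 1 ≤ D) {A : Type} [Fintype A] [Nonempty A]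
    [TopologicalSpace A] [DiscreteTopology A]
    (𝔄 : Set (Config D A)) (h𝔄 : IsSubshift 𝔄)
    {Gs : Type} [CommGroup Gs] [TopologicalSpace Gs] [DiscreteTopology Gs]
    (Cstar : (Fin D → ℤ) → Config D A → Gs)
    (hCstar : DynCocycleOn 𝔄 Cstar) (hfund : IsFundamental 𝔄 Cstar)
    (Φ : Config D A → Config D A) (hmaps : Set.MapsTo Φ 𝔄 𝔄)
    (hcont : ContinuousOn Φ 𝔄)
    (hcomm : ∀ v : Fin D → ℤ, ∀ a ∈ 𝔄, Φ (shift v a) = shift v (Φ a)) :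
    ∃ φ : Gs →* Gs, ∀ ε : Gs →* Gs,
      DynCohomologous 𝔄 (fun z a => ε (Cstar z (Φ a)))
        fun z a => ε (φ (Cstar z a)) := by
  obtain ⟨φ, b, hb, hφ⟩ := hfund Gs (fun z a => Cstar z (Φ a))
    ⟨fun z => (hCstar.1 z).comp hcont hmaps, fun y z a ha => by
      simp only [hCstar.2 y z (Φ a) (hmaps ha), hcomm z a ha]⟩
  refine ⟨φ, fun ε => ⟨fun a => ε (b a),
    (continuous_of_discreteTopology (f := ε)).comp_continuousOn hb, fun z a ha => ?_⟩⟩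
  simpa only [map_mul, map_inv] using congrArg ε (hφ z a ha)

end Defects
end

section
/- Let 𝔄 be a subshift, (G,·) a group, c a local rule of radius r for a G-valued cocycle on 𝔄, and a ∈ 𝔄̃. If a has a projective c-pole (i.e., for every R ≥ r there exists a closed trail ζ lying in G_R(a) with c(ζ, a) ≠ e_G), then the defect of a is essential. -/
open scoped ENNReal

namespace Defects

variable {D : ℕ} {A : Type}

/-- Commuting elements `t i` of a group extend to a homomorphism from `ℤ^ι`. -/
lemma exists_additive_of_commute {ι M : Type*} [Fintype ι] [DecidableEq ι] [Group M] (t : ι → M)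
    (ht : ∀ i j, Commute (t i) (t j)) :
    ∃ P : (ι → ℤ) → M, (∀ u v, P (u + v) = P u * P v) ∧ ∀ i, P (Pi.single i 1) = t i := by
  have hcomm : Pairwise fun i j => ∀ x y : Multiplicative ℤ,
      Commute (zpowersHom M (t i) x) (zpowersHom M (t j) y) := by
    intro i j _ x y
    simpa only [zpowersHom_apply] using (ht i j).zpow_zpow _ _
  let φ := MonoidHom.noncommPiCoprod (fun i => zpowersHom M (t i)) hcomm
  refine ⟨fun u => φ fun i => Multiplicative.ofAdd (u i), fun u v => ?_, fun i => ?_⟩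
  · rw [← map_mul]
    rfl
  · have h : (fun j => Multiplicative.ofAdd ((Pi.single i 1 : ι → ℤ) j)) =
        Pi.mulSingle i (Multiplicative.ofAdd (1 : ℤ)) := by
      funext j
      by_cases hj : j = i
      · subst hj
        simp
      · simp [hj]
    change φ _ = _
    rw [h]
    simp [φ]

lemma blockAt_shift (r : ℕ) (v z : Fin D → ℤ) (a : Config D A) :
    blockAt r (shift v a) z = blockAt r a (v + z) := by
  funext w
  simp only [blockAt, shift]
  congr 1
  abel

lemma shift_mem [TopologicalSpace A] {𝔄 : Set (Config D A)} (h𝔄 : IsSubshift 𝔄)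
    {a : Config D A} (ha : a ∈ 𝔄) (v : Fin D → ℤ) : shift v a ∈ 𝔄 := by
  rw [← h𝔄.2.2 v]
  exact ⟨a, ha, rfl⟩

/-- Every position of an admissible configuration is good. -/
lemma mem_goodSet_of_mem [TopologicalSpace A] {𝔄 : Set (Config D A)} (h𝔄 : IsSubshift 𝔄)
    {a : Config D A} (ha : a ∈ 𝔄) (r : ℕ) (z : Fin D → ℤ) : z ∈ goodSet 𝔄 r a :=
  ⟨shift z a, shift_mem h𝔄 ha z, by simp [blockAt_shift]⟩

/-- A point within distance `r` of a point of `G_(r+s)(a)` lies in `G_s(a)`. -/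
lemma add_mem_goodSet [TopologicalSpace A] {𝔄 : Set (Config D A)} (h𝔄 : IsSubshift 𝔄)
    {a : Config D A} {r s : ℕ} {z w : Fin D → ℤ} (hz : z ∈ goodSet 𝔄 (r + s) a)
    (hw : w ∈ ballZ D r) : z + w ∈ goodSet 𝔄 s a := by
  obtain ⟨b, hb, hbz⟩ := hz
  refine ⟨shift w b, shift_mem h𝔄 hb w, ?_⟩
  funext u
  have hu : w + u.1 ∈ ballZ D (r + s) := fun i => by
    push_cast
    exact (abs_add_le _ _).trans (add_le_add (hw i) (u.2 i))
  have h := congrFun hbz ⟨w + u.1, hu⟩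
  simp only [blockAt, zero_add] at h
  simpa only [blockAt, shift, zero_add, add_assoc, add_comm u.1 w] using h

/-- The value of a local rule along a trail depends only on the blocks along it. -/
lemma trailVal_congr {G : Type} [Group G] {r : ℕ} (c : (Fin D → ℤ) → (ballZ D r → A) → G)
    {a b : Config D A} : ∀ {ζ : List (Fin D → ℤ)},
      (∀ z ∈ ζ, blockAt r a z = blockAt r b z) → trailVal c a ζ = trailVal c b ζ
  | [], _ => rfl
  | [_], _ => rfl
  | x :: y :: ζ, h => by
    simp only [trailVal]
    rw [h x (by simp), trailVal_congr c fun z hz => h z (List.mem_cons_of_mem _ hz)]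

/-- Moving along the positive unit vector `e_i` while accumulating the value of a local rule. -/
def skewStep {G : Type} [Group G] {r : ℕ} (c : (Fin D → ℤ) → (ballZ D r → A) → G)
    (a : Config D A) (i : Fin D) : Equiv.Perm ((Fin D → ℤ) × G) where
  toFun p := (p.1 + Pi.single i 1, c (Pi.single i 1) (blockAt r a p.1) * p.2)
  invFun p := (p.1 - Pi.single i 1,
    (c (Pi.single i 1) (blockAt r a (p.1 - Pi.single i 1)))⁻¹ * p.2)
  left_inv p := by simp
  right_inv p := by simp

/-- On an admissible configuration the local rule extends to an action of `ℤ^D` on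
`ℤ^D × G` by skew translations. -/
lemma exists_skew_action [TopologicalSpace A] {𝔄 : Set (Config D A)} (h𝔄 : IsSubshift 𝔄)
    {G : Type} [Group G] {r : ℕ} {c : (Fin D → ℤ) → (ballZ D r → A) → G}
    (hc : IsLocalRule 𝔄 r c) {a : Config D A} (ha : a ∈ 𝔄) :
    ∃ P : (Fin D → ℤ) → Equiv.Perm ((Fin D → ℤ) × G), (∀ u v, P (u + v) = P u * P v) ∧
      ∀ e ∈ stdSteps D, ∀ x g, P e (x, g) = (x + e, c e (blockAt r a x) * g) := by
  have hgood (x z : Fin D → ℤ) : z ∈ goodSet 𝔄 r (shift x a) :=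
    mem_goodSet_of_mem h𝔄 (shift_mem h𝔄 ha x) r z
  have hpos (i : Fin D) : (Pi.single i 1 : Fin D → ℤ) ∈ stdSteps D := ⟨i, Or.inl rfl⟩
  have hcomm (i j : Fin D) : Commute (skewStep c a i) (skewStep c a j) := by
    refine Equiv.ext fun ⟨x, g⟩ => ?_
    have h := (hc (shift x a) _ (hpos j) _ (hpos i)).1
      ⟨hgood _ _, hgood _ _, hgood _ _, hgood _ _⟩
    simp only [blockAt_shift, add_zero] at h
    simp only [Equiv.Perm.mul_apply, skewStep, Equiv.coe_fn_mk, ← mul_assoc, h]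
    rw [add_right_comm]
  obtain ⟨P, hadd, hP⟩ := exists_additive_of_commute (skewStep c a) hcomm
  refine ⟨P, hadd, ?_⟩
  rintro _ ⟨i, rfl | rfl⟩ x g
  · rw [hP]
    rfl
  · have h0 : P 0 = 1 := by simpa using hadd 0 0
    have hinv : P (-Pi.single i 1) = (skewStep c a i)⁻¹ := by
      rw [eq_inv_iff_mul_eq_one, ← hP, ← hadd, neg_add_cancel, h0]
    have h := (hc (shift (x - Pi.single i 1) a) _ (hpos i) _ (hpos i)).2
      ⟨hgood _ _, hgood _ _⟩
    simp only [blockAt_shift, add_zero, sub_add_cancel] at h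
    rw [hinv, h, ← sub_eq_add_neg]
    rfl

/-- A local rule is trivial along every closed trail of an admissible configuration. -/
lemma trailVal_eq_one_of_mem [TopologicalSpace A] {𝔄 : Set (Config D A)} (h𝔄 : IsSubshift 𝔄)
    {G : Type} [Group G] {r : ℕ} {c : (Fin D → ℤ) → (ballZ D r → A) → G}
    (hc : IsLocalRule 𝔄 r c) {a : Config D A} (ha : a ∈ 𝔄) {ζ : List (Fin D → ℤ)}
    (hζ : IsTrail ζ) (hclosed : IsClosedTrail ζ) : trailVal c a ζ = 1 := by
  obtain ⟨P, hadd, hP⟩ := exists_skew_action h𝔄 hc ha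
  have h0 : P 0 = 1 := by simpa using hadd 0 0
  have key : ∀ (ζ : List (Fin D → ℤ)) (x y : Fin D → ℤ) (g : G),
      (ζ.IsChain fun x y => y - x ∈ stdSteps D) → ζ.head? = some x → ζ.getLast? = some y →
        P (y - x) (x, g) = (y, trailVal c a ζ * g) := by
    intro ζ
    induction ζ with
    | nil => simp
    | cons z ζ ih =>
      intro x y g hchain hx hy
      obtain rfl : z = x := by simpa using hx
      cases ζ with
      | nil =>
        obtain rfl : z = y := by simpa using hy
        simp [trailVal, h0]
      | cons w ζ =>
        rw [List.isChain_cons_cons] at hchain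
        have h := ih w y (c (w - z) (blockAt r a z) * g) hchain.2 rfl
          (by simpa [List.getLast?_cons_cons] using hy)
        rw [← sub_add_sub_cancel y w z, hadd, Equiv.Perm.mul_apply, hP _ hchain.1,
          add_sub_cancel, h, trailVal, mul_assoc]
  obtain ⟨z, ζ, rfl⟩ := List.exists_cons_of_ne_nil hζ.1
  have h := key _ z z 1 hζ.2 rfl hclosed.symm
  rw [sub_self, h0, mul_one] at h
  exact (congrArg Prod.snd h).symm

theorem statement_9 {D : ℕ} (hD : 1 ≤ D) {A : Type} [Fintype A] [Nonempty A]
    [TopologicalSpace A] [DiscreteTopology A]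
    (𝔄 : Set (Config D A)) (h𝔄 : IsSubshift 𝔄)
    {G : Type} [Group G] (r : ℕ)
    (c : (Fin D → ℤ) → (ballZ D r → A) → G) (hc : IsLocalRule 𝔄 r c)
    (a : Config D A) (ha : a ∈ almostAdmissible 𝔄)
    (hpole : HasProjPole 𝔄 r c a) :
    ¬ Removable 𝔄 a := by
  rintro ⟨s, a', ha', hagree⟩
  obtain ⟨ζ, hζ, hclosed, hgood, hval⟩ := hpole (r + s) (Nat.le_add_right r s)
  refine hval ?_
  rw [← trailVal_eq_one_of_mem h𝔄 hc ha' hζ hclosed]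
  refine trailVal_congr c fun z hz => funext fun w => ?_
  exact (hagree _ (add_mem_goodSet h𝔄 (hgood z hz) w.2)).symm

end Defects
end
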